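/- Let $n \ge 1$ and $1 \le k \le n$. Let $X = [X_0, X_1]$ and $Y = [Y_0, Y_1]$ be two $n \times n$ real orthogonal matrices, where $X_0, Y_0 \in \mathbb{R}^{n \times k}$ consist of the first $k$ columns of $X$ and $Y$ respectively, and $X_1, Y_1 \in \mathbb{R}^{n \times (n-k)}$ consist of the remaining $n-k$ columns. Then $\|X_0 X_0^T - Y_0 Y_0^T\|_F = \sqrt{2}\, \|X_0^T Y_1\|_F$, where $\|\cdot\|_F$ denotes the Frobenius norm. -/

import Mathlib

open Matrix BigOperators

/-- Frobenius norm of a real matrix. -/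
noncomputable def frob {m n : Type*} [Fintype m] [Fintype n] (A : Matrix m n ℝ) : ℝ :=
  Real.sqrt (∑ i, ∑ j, (A i j) ^ 2)

/-- The submatrix consisting of the first `k` columns of an `n × n` matrix. -/
def firstCols {n : ℕ} (X : Matrix (Fin n) (Fin n) ℝ) (k : ℕ) : Matrix (Fin n) (Fin k) ℝ :=
  Matrix.of fun r j => if h : j.1 < n then X r ⟨j.1, h⟩ else 0

/-- The submatrix consisting of the last `n - a` columns (columns `a+1, …, n`)
of an `n × n` matrix. -/
def lastCols {n : ℕ} (X : Matrix (Fin n) (Fin n) ℝ) (a : ℕ) : Matrix (Fin n) (Fin (n - a)) ℝ :=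
  Matrix.of fun r j => if h : a + j.1 < n then X r ⟨a + j.1, h⟩ else 0

theorem frob_sq {m n : Type*} [Fintype m] [Fintype n] (A : Matrix m n ℝ) :
    frob A ^ 2 = (A * Aᵀ).trace := by
  rw [frob, Real.sq_sqrt (by positivity)]
  simp [Matrix.trace, Matrix.mul_apply, sq]

theorem firstCols_transpose_mul_self {n k : ℕ} (hkn : k ≤ n) {X : Matrix (Fin n) (Fin n) ℝ}
    (hX : Xᵀ * X = 1) : (firstCols X k)ᵀ * firstCols X k = 1 := by
  ext i j
  have h := congrFun (congrFun hX (Fin.castLE hkn i)) (Fin.castLE hkn j)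
  simpa [Matrix.mul_apply, Matrix.one_apply, firstCols, i.2.trans_le hkn, j.2.trans_le hkn,
    Fin.ext_iff, Fin.castLE] using h

theorem firstCols_mul_add_lastCols_mul {n k : ℕ} (hkn : k ≤ n) (Y : Matrix (Fin n) (Fin n) ℝ) :
    firstCols Y k * (firstCols Y k)ᵀ + lastCols Y k * (lastCols Y k)ᵀ = Y * Yᵀ := by
  ext i j
  let g : ℕ → ℝ := fun l => (if h : l < n then Y i ⟨l, h⟩ else 0) *
    (if h : l < n then Y j ⟨l, h⟩ else 0)
  have hg : ∑ l : Fin n, Y i l * Y j l = ∑ l : Fin n, g l :=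
    Finset.sum_congr rfl fun l _ => by simp [g]
  simp only [Matrix.add_apply, Matrix.mul_apply, Matrix.transpose_apply, hg]
  change ∑ l : Fin k, g l + ∑ l : Fin (n - k), g (k + l) = _
  rw [Fin.sum_univ_eq_sum_range g, Fin.sum_univ_eq_sum_range (fun l => g (k + l)),
    Fin.sum_univ_eq_sum_range g, ← Finset.sum_range_add, Nat.add_sub_cancel' hkn]

theorem stmt0 {n k : ℕ} (hn : 1 ≤ n) (hk : 1 ≤ k) (hkn : k ≤ n)
    (X Y : Matrix (Fin n) (Fin n) ℝ)
    (hX : Xᵀ * X = 1) (hX' : X * Xᵀ = 1)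
    (hY : Yᵀ * Y = 1) (hY' : Y * Yᵀ = 1) :
    frob (firstCols X k * (firstCols X k)ᵀ - firstCols Y k * (firstCols Y k)ᵀ) =
      Real.sqrt 2 * frob ((firstCols X k)ᵀ * lastCols Y k) := by
  have hX₀ := firstCols_transpose_mul_self hkn hX
  have hY₀ := firstCols_transpose_mul_self hkn hY
  have hsum := (firstCols_mul_add_lastCols_mul hkn Y).trans hY'
  have hnonneg {m n : Type} [Fintype m] [Fintype n] (A : Matrix m n ℝ) : 0 ≤ frob A :=
    Real.sqrt_nonneg _
  rw [← sq_eq_sq₀ (hnonneg _) (mul_nonneg (Real.sqrt_nonneg _) (hnonneg _)), mul_pow,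
    Real.sq_sqrt zero_le_two, frob_sq, frob_sq]
  generalize firstCols X k = A at *
  generalize firstCols Y k = B at *
  generalize lastCols Y k = C at *
  have hAA : A * Aᵀ * (A * Aᵀ) = A * Aᵀ := by
    rw [Matrix.mul_assoc, ← Matrix.mul_assoc Aᵀ, hX₀, Matrix.one_mul]
  have hBB : B * Bᵀ * (B * Bᵀ) = B * Bᵀ := by
    rw [Matrix.mul_assoc, ← Matrix.mul_assoc Bᵀ, hY₀, Matrix.one_mul]
  have htr : (A * Aᵀ).trace = (B * Bᵀ).trace := by
    rw [Matrix.trace_mul_comm, hX₀, Matrix.trace_mul_comm B, hY₀]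
  have hC : (Aᵀ * C * (Aᵀ * C)ᵀ).trace = (A * Aᵀ).trace - (A * Aᵀ * (B * Bᵀ)).trace := by
    rw [← Matrix.trace_sub, ← Matrix.mul_one (A * Aᵀ), Matrix.mul_assoc (A * Aᵀ) 1,
      Matrix.one_mul, ← Matrix.mul_sub, ← hsum, add_sub_cancel_left, Matrix.transpose_mul,
      Matrix.transpose_transpose, ← Matrix.mul_assoc, Matrix.trace_mul_comm]
    simp only [Matrix.mul_assoc]
  rw [hC, Matrix.transpose_sub, Matrix.transpose_mul, Matrix.transpose_mul,
    Matrix.transpose_transpose, Matrix.transpose_transpose, Matrix.sub_mul, Matrix.mul_sub,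
    Matrix.mul_sub, hAA, hBB, Matrix.trace_sub, Matrix.trace_sub, Matrix.trace_sub,
    Matrix.trace_mul_comm (B * Bᵀ) (A * Aᵀ), htr]
  ring
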